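/- Let p > 2 be a prime, q a power of p, let g ∈ F_q[x] be a monic squarefree polynomial, and let Q be a monic divisor of g. Let N = ((F_q[x]/gQ)^×)^p be the subgroup of p-th powers in (F_q[x]/gQ)^×. Then for every integer r ≥ 1: ψ(r; N) ≤ q^{r/p} if r ≤ deg Q; ψ(r; N) ≤ r·q^{r/2 + (1/2 − 1/p)(r − 2·deg Q) + min(2p, r/p)} if deg Q < r < 2·deg Q; and ψ(r; N) ≤ r·q^{r/2 + (r − 2·deg Q)/2 + min(2p, r/p)} if r ≥ 2·deg Q. -/

import Mathlib

open Polynomial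

/-- The von Mangoldt function on `F_q[x]`: `Λ(c) = deg P` if `c = P^k` for a monic
irreducible `P` and `k ≥ 1`, and `Λ(c) = 0` otherwise. -/
noncomputable def vM {F : Type*} [Field F] (c : Polynomial F) : ℕ :=
  sSup {n : ℕ | ∃ (P : Polynomial F) (k : ℕ),
    P.Monic ∧ Irreducible P ∧ 1 ≤ k ∧ c = P ^ k ∧ n = P.natDegree}


section Comb

theorem cnt_mono (p : ℕ) (S : ℕ → Prop) [DecidablePred S] (hS : ∀ n, S n → S (n + p)) (a j : ℕ) :
    Nat.count S (a + p) + Nat.count S (a + j) ≤ Nat.count S (a + j + p) + Nat.count S a := by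
  induction j with
  | zero => simp [Nat.add_comm]
  | succ j ih =>
    have h1 : a + (j + 1) + p = (a + j + p) + 1 := by ring
    have h2 : a + (j + 1) = (a + j) + 1 := by ring
    rw [h1, h2, Nat.count_succ, Nat.count_succ]
    have h3 := hS (a + j)
    split_ifs <;> first | omega | (exfalso; tauto)

theorem cnt_fwd (p : ℕ) (S : ℕ → Prop) [DecidablePred S] (hS : ∀ n, S n → S (n + p)) (r m : ℕ) :
    (Nat.count S r : ℝ) + m * ((Nat.count S (r + p) : ℝ) - Nat.count S r)
      ≤ Nat.count S (r + m * p) := by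
  induction m with
  | zero => simp
  | succ m ih =>
    have h := cnt_mono p S hS r (m * p)
    have h1 : r + (m + 1) * p = r + m * p + p := by ring
    rw [h1]
    have h' : (Nat.count S (r + p) : ℝ) + Nat.count S (r + m * p)
      ≤ Nat.count S (r + m * p + p) + Nat.count S r := by exact_mod_cast h
    push_cast
    linarith

theorem cnt_bwd (p : ℕ) (S : ℕ → Prop) [DecidablePred S] (hS : ∀ n, S n → S (n + p))
    (r r0 k : ℕ) (h : r0 + k * p ≤ r) :
    (Nat.count S (r0 + k * p) : ℝ) ≤
      Nat.count S r0 + k * ((Nat.count S (r + p) : ℝ) - Nat.count S r) := by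
  induction k with
  | zero => simp
  | succ k ih =>
    have h1 : r0 + (k + 1) * p = r0 + k * p + p := by ring
    have ih := ih (by omega)
    obtain ⟨j, hj⟩ := Nat.exists_eq_add_of_le (show r0 + k * p ≤ r by omega)
    have h := cnt_mono p S hS (r0 + k * p) j
    rw [← hj] at h
    have h' : (Nat.count S (r0 + k * p + p) : ℝ) + Nat.count S r
      ≤ Nat.count S (r + p) + Nat.count S (r0 + k * p) := by exact_mod_cast h
    rw [h1]
    push_cast
    linarith

theorem cnt_mul_le (p : ℕ) (hp : 0 < p) (r : ℕ) :
    p * Nat.count (fun n => p ∣ n) r + 1 ≤ r + p := by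
  have h2 : Nat.count (fun n => p ∣ n) r = r / p + if 0 % p < r % p then 1 else 0 := by
    rw [← Nat.count_modEq_card (b := r) (r := p) hp 0]
    simp only [Nat.count_eq_card_filter_range, Nat.modEq_zero_iff_dvd]
  rw [h2]
  have h3 := Nat.div_add_mod r p
  rw [Nat.zero_mod]
  split_ifs with h4
  · rw [Nat.mul_add]; omega
  · rw [Nat.mul_add]; omega

theorem cnt_small (p d : ℕ) (S : ℕ → Prop) [DecidablePred S]
    (h1 : ∀ n, S n → n ≤ d → p ∣ n) (r : ℕ) (hr : r ≤ d + 1) :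
    Nat.count S r ≤ Nat.count (fun n => p ∣ n) r := by
  induction r with
  | zero => simp
  | succ r ih =>
    rw [Nat.count_succ, Nat.count_succ]
    have := ih (by omega)
    have h3 := h1 r
    split_ifs <;> first | omega | (exfalso; grind)

theorem cnt_triv (p d : ℕ) (S : ℕ → Prop) [DecidablePred S]
    (h1 : ∀ n, S n → n ≤ d → p ∣ n) (r : ℕ) :
    Nat.count S (d + 1 + r) ≤ Nat.count (fun n => p ∣ n) (d + 1 + r) + r := by
  induction r with
  | zero => exact cnt_small p d S h1 _ le_rfl
  | succ r ih =>
    rw [← Nat.add_assoc, Nat.count_succ, Nat.count_succ]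
    split_ifs <;> omega

theorem comb_main (p d : ℕ) (hp : 2 < p) (S : ℕ → Prop) [DecidablePred S]
    (hS : ∀ n, S n → S (n + p)) (h1 : ∀ n, S n → n ≤ d → p ∣ n)
    (h2 : ∀ R, 2 * d ≤ R → Nat.count S R + d ≤ R) (r : ℕ) (hr : d < r) (hr2 : r < 2 * d) :
    (Nat.count S r : ℝ) ≤ (r : ℝ) / 2 + (1 / 2 - 1 / (p : ℝ)) * ((r : ℝ) - 2 * (d : ℝ)) +
            min (2 * (p : ℝ)) ((r : ℝ) / (p : ℝ)) := by
  have hp0 : (0 : ℝ) < p := by positivity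
  have hp3 : (3 : ℝ) ≤ p := by exact_mod_cast hp
  have hrR : (r : ℝ) < 2 * d := by exact_mod_cast hr2
  have hform : (r : ℝ) / 2 + (1 / 2 - 1 / (p : ℝ)) * ((r : ℝ) - 2 * (d : ℝ))
      = r - d + (2 * d - r) / p := by field_simp; ring
  rw [hform]
  rcases le_total (2 * (p : ℝ)) ((r : ℝ) / p) with h | h
  · rw [min_eq_left h]
    rw [le_div_iff₀ hp0] at h
    have hpd : p ≤ d := by
      have : (p : ℝ) ≤ d := by nlinarith
      exact_mod_cast this
    obtain ⟨k, hk⟩ : ∃ k, k = (r - d + p - 1) / p := ⟨_, rfl⟩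
    obtain ⟨m, hm⟩ : ∃ m, m = (2 * d - r + p - 1) / p := ⟨_, rfl⟩
    have hkd := Nat.div_add_mod (r - d + p - 1) p
    have hkm := Nat.mod_lt (r - d + p - 1) (show p > 0 by omega)
    have hmd := Nat.div_add_mod (2 * d - r + p - 1) p
    have hmm := Nat.mod_lt (2 * d - r + p - 1) (show p > 0 by omega)
    rw [← hk, Nat.mul_comm] at hkd
    rw [← hm, Nat.mul_comm] at hmd
    obtain ⟨r0, hr0⟩ := Nat.exists_eq_add_of_le' (show k * p ≤ r by omega)
    have hR := h2 (r + m * p) (by omega)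
    have hf := cnt_fwd p S hS r m
    have hb := cnt_bwd p S hS r r0 k hr0.ge
    rw [← hr0] at hb
    have hc0 := cnt_small p d S h1 r0 (by omega)
    have hc1 := cnt_mul_le p (by omega) r0
    have hk1 : 1 ≤ k := by
      by_contra hcon
      have : k = 0 := by omega
      subst this
      omega
    have hc2 : p * Nat.count S r0 + 1 ≤ r0 + p := by
      have := Nat.mul_le_mul_left p hc0
      omega
    have e1 : k * p ≤ r - d + p := by omega
    have e2 : m * p ≤ 2 * d - r + p := by omega
    have e3 : r0 ≤ d := by omega
    have e4 : 2 * d ≤ r + m * p := by omega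
    clear hkd hkm hmd hmm hk hm
    have E1 : (k : ℝ) * p ≤ r - d + p := by
      rw [← Nat.cast_sub hr.le]; exact_mod_cast e1
    have E2 : (m : ℝ) * p ≤ 2 * d - r + p := by
      have : ((2 * d : ℕ) : ℝ) = 2 * d := by push_cast; ring
      rw [← this, ← Nat.cast_sub hr2.le]; exact_mod_cast e2
    have E3 : (r0 : ℝ) ≤ d := by exact_mod_cast e3
    have E4 : (2 : ℝ) * d ≤ r + m * p := by exact_mod_cast e4
    have E5 : (r : ℝ) = r0 + k * p := by exact_mod_cast hr0
    have E6 : (Nat.count S (r + m * p) : ℝ) + d ≤ r + m * p := by exact_mod_cast hR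
    have E7 : (p : ℝ) * Nat.count S r0 + 1 ≤ r0 + p := by exact_mod_cast hc2
    have E8 : (1 : ℝ) ≤ k := by exact_mod_cast hk1
    generalize (Nat.count S (r + m * p) : ℝ) = fR at *
    generalize (Nat.count S (r + p) : ℝ) - Nat.count S r = D at *
    generalize (Nat.count S r0 : ℝ) = f0 at *
    generalize (Nat.count S r : ℝ) = f at *
    have hm0 : (0 : ℝ) ≤ m := by positivity
    have A1 : fR ≤ p * (k + m) := by linarith
    have A2 : f0 ≤ (k + m) + 1 := by
      have : p * f0 ≤ p * ((k + m) + 1) := by linarith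
      exact le_of_mul_le_mul_left this hp0
    have A3 : (k + m) * f ≤ k * fR + m * f0 := by
      have := mul_le_mul_of_nonneg_left hf (show (0 : ℝ) ≤ k by linarith)
      have := mul_le_mul_of_nonneg_left hb hm0
      linarith
    have A4 : ((k : ℝ) + m) * f ≤ (k + m) * (k * p + m + 1) := by
      have := mul_le_mul_of_nonneg_left A1 (show (0 : ℝ) ≤ k by linarith)
      have := mul_le_mul_of_nonneg_left A2 hm0
      nlinarith
    have A5 : f ≤ k * p + m + 1 := le_of_mul_le_mul_left A4 (by linarith)
    have A6 : (m : ℝ) ≤ (2 * d - r) / p + 1 := by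
      rw [← sub_le_iff_le_add, le_div_iff₀ hp0]; linarith
    linarith
  · rw [min_eq_right h]
    obtain ⟨j, hj⟩ := Nat.exists_eq_add_of_le (show d + 1 ≤ r by omega)
    have ht := cnt_triv p d S h1 j
    rw [← hj] at ht
    have hc := cnt_mul_le p (by omega) r
    have T1 : (Nat.count S r : ℝ) ≤ Nat.count (fun n => p ∣ n) r + j := by exact_mod_cast ht
    have T2 : (p : ℝ) * Nat.count (fun n => p ∣ n) r + 1 ≤ r + p := by exact_mod_cast hc
    have T3 : (r : ℝ) = d + 1 + j := by exact_mod_cast hj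
    have T4 : (Nat.count (fun n => p ∣ n) r : ℝ) ≤ r / p + 1 := by
      rw [← sub_le_iff_le_add, le_div_iff₀ hp0]; linarith
    have T5 : 0 ≤ (2 * (d : ℝ) - r) / p := div_nonneg (by linarith) hp0.le
    linarith

end Comb
section Lin

variable {K : Type*} [Field K]

/-- Polynomials whose derivative is divisible by `Q`. -/
noncomputable def LQ (Q : K[X]) : Submodule K K[X] where
  carrier := {c | Q ∣ derivative c}
  add_mem' := by
    intro a b ha hb
    simp only [Set.mem_ofPred_eq, derivative_add] at *
    exact dvd_add ha hb
  zero_mem' := by simp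
  smul_mem' := by
    intro a b hb
    simp only [Set.mem_ofPred_eq, derivative_smul] at *
    rw [smul_eq_C_mul]; exact Dvd.dvd.mul_left hb _

theorem mem_LQ (Q c : K[X]) : c ∈ LQ Q ↔ Q ∣ derivative c := Iff.rfl

theorem finrank_dLT (n : ℕ) : Module.finrank K (degreeLT K n) = n := by
  rw [(degreeLTEquiv K n).finrank_eq]; simp

instance fd_dLT (n : ℕ) : FiniteDimensional K (degreeLT K n) :=
  Module.Finite.equiv (degreeLTEquiv K n).symm

instance fd_LQ (Q : K[X]) (n : ℕ) : FiniteDimensional K (LQ Q ⊓ degreeLT K n : Submodule K K[X]) :=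
  Submodule.finiteDimensional_of_le (inf_le_right : LQ Q ⊓ degreeLT K n ≤ degreeLT K n)

/-- degrees of elements of `LQ Q` -/
def SQ (Q : K[X]) (n : ℕ) : Prop := ∃ c ∈ LQ Q, c ≠ 0 ∧ c.natDegree = n

theorem rank_step (Q : K[X]) (r : ℕ) [Decidable (SQ Q r)] :
    Module.finrank K (LQ Q ⊓ degreeLT K (r + 1) : Submodule K K[X])
    = Module.finrank K (LQ Q ⊓ degreeLT K r : Submodule K K[X]) + if SQ Q r then 1 else 0 := by
  set V := (LQ Q ⊓ degreeLT K (r + 1) : Submodule K K[X]) with hV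
  set φ : V →ₗ[K] K := (lcoeff K r).domRestrict V with hφ
  have hk : (LinearMap.ker φ).map V.subtype = LQ Q ⊓ degreeLT K r := by
    ext c
    simp only [Submodule.mem_map, LinearMap.mem_ker, Submodule.subtype_apply, Subtype.exists,
      exists_and_right, exists_eq_right, hφ, LinearMap.domRestrict_apply, lcoeff_apply, hV,
      Submodule.mem_inf, mem_degreeLT]
    constructor
    · rintro ⟨⟨h1, h2⟩, h3⟩
      refine ⟨h1, ?_⟩
      rw [degree_lt_iff_coeff_zero] at *
      intro m hm
      rcases hm.eq_or_lt with rfl | hm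
      · exact h3
      · exact h2 m hm
    · rintro ⟨h1, h2⟩
      rw [degree_lt_iff_coeff_zero] at *
      exact ⟨⟨h1, fun m hm => h2 m (by omega)⟩, h2 r le_rfl⟩
  have hkr : Module.finrank K (LinearMap.ker φ) =
      Module.finrank K (LQ Q ⊓ degreeLT K r : Submodule K K[X]) := by
    rw [← hk, Submodule.finrank_map_subtype_eq]
  have hrn := LinearMap.finrank_range_add_finrank_ker φ
  rw [hkr] at hrn
  have hrange : Module.finrank K (LinearMap.range φ) = if SQ Q r then 1 else 0 := by
    split_ifs with h
    · obtain ⟨c, hc, hc0, hcr⟩ := h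
      have hs : Function.Surjective φ := by
        apply LinearMap.surjective
        intro h0
        have hcV : c ∈ V := by
          refine Submodule.mem_inf.mpr ⟨hc, ?_⟩
          rw [mem_degreeLT, degree_eq_natDegree hc0, hcr]
          exact_mod_cast Nat.lt_succ_self r
        have := LinearMap.congr_fun h0 ⟨c, hcV⟩
        simp only [hφ, LinearMap.domRestrict_apply, lcoeff_apply, LinearMap.zero_apply] at this
        rw [← hcr] at this
        exact hc0 (leadingCoeff_eq_zero.mp this)
      rw [LinearMap.range_eq_top.mpr hs]; simp
    · have : φ = 0 := by
        ext ⟨c, hcV⟩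
        simp only [hφ, LinearMap.domRestrict_apply, lcoeff_apply, LinearMap.zero_apply]
        by_contra hne
        apply h
        refine ⟨c, hcV.1, fun h0 => hne (by simp [h0]), ?_⟩
        have h1 := le_natDegree_of_ne_zero hne
        have h2 : c.natDegree < r + 1 := by
          have := mem_degreeLT.mp hcV.2
          exact (natDegree_lt_iff_degree_lt (fun h0 => hne (by simp [h0]))).mpr this
        omega
      rw [this]; simp
  omega

theorem rank_eq_count (Q : K[X]) [DecidablePred (SQ Q)] (r : ℕ) :
    Module.finrank K (LQ Q ⊓ degreeLT K r : Submodule K K[X]) = Nat.count (SQ Q) r := by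
  induction r with
  | zero =>
    have : (LQ Q ⊓ degreeLT K 0 : Submodule K K[X]) = ⊥ := by
      rw [eq_bot_iff]
      rintro c ⟨_, hc⟩
      have := mem_degreeLT.mp hc
      simpa using this
    rw [this]; simp
  | succ r ih => rw [rank_step, ih, Nat.count_succ]

theorem rank_large (Q : K[X]) (hQ : Q.Monic) (hs : Q.Separable) (R : ℕ)
    (hR : 2 * Q.natDegree ≤ R) :
    Module.finrank K (LQ Q ⊓ degreeLT K R : Submodule K K[X]) + Q.natDegree = R := by
  set φ : degreeLT K R →ₗ[K] K[X] :=
    ((modByMonicHom Q).comp derivative).domRestrict (degreeLT K R) with hφ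
  have hk : (LinearMap.ker φ).map (degreeLT K R).subtype = LQ Q ⊓ degreeLT K R := by
    ext c
    simp only [Submodule.mem_map, LinearMap.mem_ker, Submodule.subtype_apply, Subtype.exists,
      exists_and_right, exists_eq_right, hφ, LinearMap.domRestrict_apply, LinearMap.comp_apply,
      Submodule.mem_inf, mem_LQ, modByMonicHom_apply, modByMonic_eq_zero_iff_dvd hQ]
    tauto
  have hr : LinearMap.range φ = degreeLT K Q.natDegree := by
    ext e
    rw [LinearMap.mem_range, mem_degreeLT]
    constructor
    · rintro ⟨c, rfl⟩
      rw [← degree_eq_natDegree hQ.ne_zero]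
      exact degree_modByMonic_lt _ hQ
    · intro he
      obtain ⟨a, b, hab⟩ := hs
      have hc : Q * ((b * e) %ₘ Q) ∈ degreeLT K R := by
        rw [mem_degreeLT, degree_mul]
        have h1 := degree_modByMonic_lt (b * e) hQ
        rw [degree_eq_natDegree hQ.ne_zero] at *
        by_cases h0 : (b * e) %ₘ Q = 0
        · simp [h0]
        · rw [degree_eq_natDegree h0] at *
          norm_cast at *
          omega
      refine ⟨⟨_, hc⟩, ?_⟩
      simp only [hφ, LinearMap.domRestrict_apply, LinearMap.comp_apply, modByMonicHom_apply]
      have h2 := modByMonic_add_div (b * e) Q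
      have he' : e %ₘ Q = e := by
        rw [modByMonic_eq_self_iff hQ, degree_eq_natDegree hQ.ne_zero]; exact he
      conv_rhs => rw [← he']
      rw [← sub_eq_zero, ← sub_modByMonic, modByMonic_eq_zero_iff_dvd hQ, derivative_mul]
      generalize (b * e) %ₘ Q = u at *
      generalize (b * e) /ₘ Q = v at *
      refine ⟨derivative u - derivative Q * v - a * e, ?_⟩
      have : u = b * e - Q * v := by rw [← h2]; ring
      have h3 : e = (a * Q + b * derivative Q) * e := by rw [hab, one_mul]
      generalize derivative u = u' at *
      rw [this]
      linear_combination (-1 : K[X]) * h3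
  have hrn := LinearMap.finrank_range_add_finrank_ker φ
  rw [hr, ← Submodule.finrank_map_subtype_eq, hk, finrank_dLT, finrank_dLT] at hrn
  omega

theorem SQ_add (p : ℕ) [CharP K p] (Q : K[X]) (n : ℕ) (h : SQ Q n) : SQ Q (n + p) := by
  obtain ⟨c, hc, hc0, hn⟩ := h
  refine ⟨c * X ^ p, ?_, ?_, ?_⟩
  · rw [mem_LQ] at *
    rw [derivative_mul, derivative_X_pow]
    simp only [CharP.cast_eq_zero, map_zero, zero_mul, mul_zero, add_zero]
    exact Dvd.dvd.mul_right hc _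
  · exact mul_ne_zero hc0 (pow_ne_zero _ X_ne_zero)
  · rw [natDegree_mul_X_pow _ hc0, hn]

theorem der_zero_of_dvd (Q c : K[X]) (h : Q ∣ derivative c)
    (hd : c.natDegree ≤ Q.natDegree) (h1 : 1 ≤ c.natDegree) : derivative c = 0 := by
  by_contra hne
  have := natDegree_le_of_dvd h hne
  have := natDegree_derivative_lt (p := c) (by omega)
  omega

theorem SQ_small (p : ℕ) [CharP K p] (Q : K[X]) (n : ℕ) (h : SQ Q n) (hn : n ≤ Q.natDegree) :
    p ∣ n := by
  obtain ⟨c, hc, hc0, rfl⟩ := h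
  rcases Nat.eq_zero_or_pos c.natDegree with h0 | h0
  · simp [h0]
  have hz := der_zero_of_dvd Q c hc hn h0
  have := congrArg (fun f => coeff f (c.natDegree - 1)) hz
  simp only [coeff_derivative, coeff_zero] at this
  rw [Nat.sub_add_cancel h0] at this
  rcases mul_eq_zero.mp this with h1 | h1
  · exact absurd (leadingCoeff_eq_zero.mp h1) hc0
  · rw [← Nat.cast_succ, Nat.succ_eq_add_one, Nat.sub_add_cancel h0] at h1
    exact (CharP.cast_eq_zero_iff K p _).mp h1

theorem monic_count [Fintype K] (Q : K[X]) [DecidablePred (SQ Q)] (r : ℕ) (s : Finset K[X])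
    (hs : ∀ c ∈ s, c.Monic ∧ c.natDegree = r ∧ Q ∣ derivative c) :
    s.card ≤ Fintype.card K ^ Nat.count (SQ Q) r := by
  rcases s.eq_empty_or_nonempty with rfl | ⟨c0, h0⟩
  · simp
  have : Finite (LQ Q ⊓ degreeLT K r : Submodule K K[X]) := Module.finite_of_finite K
  have hcard := Module.natCard_eq_pow_finrank (K := K)
    (V := (LQ Q ⊓ degreeLT K r : Submodule K K[X]))
  rw [rank_eq_count, Nat.card_eq_fintype_card (α := K)] at hcard
  rw [← hcard]
  have hmem : ∀ c : s, (c : K[X]) - c0 ∈ (LQ Q ⊓ degreeLT K r : Submodule K K[X]) := by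
    rintro ⟨c, hc⟩
    obtain ⟨h1, h2, h3⟩ := hs c hc
    obtain ⟨g1, g2, g3⟩ := hs c0 h0
    refine Submodule.mem_inf.mpr ⟨?_, ?_⟩
    · show Q ∣ derivative (c - c0)
      rw [derivative_sub]; exact dvd_sub h3 g3
    · rw [mem_degreeLT]
      have := degree_sub_lt_left (p := c) (q := c0)
        (by rw [degree_eq_natDegree h1.ne_zero, degree_eq_natDegree g1.ne_zero, h2, g2])
        h1.ne_zero (by rw [h1.leadingCoeff, g1.leadingCoeff])
      rwa [degree_eq_natDegree h1.ne_zero, h2] at this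
  have hinj : Function.Injective
      (fun c : s => (⟨(c : K[X]) - c0, hmem c⟩ : (LQ Q ⊓ degreeLT K r : Submodule K K[X]))) := by
    intro x y hxy
    have := congrArg Subtype.val hxy
    simp only [sub_left_inj] at this
    exact Subtype.ext this
  have := Nat.card_le_card_of_injective _ hinj
  simpa using this

end Lin

section Psi

variable {K : Type*} [Field K]

theorem dvd_der_of_pow (p : ℕ) [CharP K p] (g Q : K[X]) (hQg : Q ∣ g) (c : K[X])
    (w : (K[X] ⧸ Ideal.span {g * Q})ˣ)
    (hw : ((w ^ p : (K[X] ⧸ Ideal.span {g * Q})ˣ) : K[X] ⧸ Ideal.span {g * Q}) =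
      Ideal.Quotient.mk (Ideal.span {g * Q}) c) : Q ∣ derivative c := by
  obtain ⟨a, ha⟩ := Ideal.Quotient.mk_surjective (w : K[X] ⧸ Ideal.span {g * Q})
  rw [Units.val_pow_eq_pow_val, ← ha, ← map_pow, Ideal.Quotient.eq,
    Ideal.mem_span_singleton] at hw
  obtain ⟨e, he⟩ := hw
  obtain ⟨f, rfl⟩ := hQg
  have h1 : derivative (a ^ p) = 0 := by
    rw [derivative_pow]; simp
  have h2 : c = a ^ p - Q * (Q * (f * e)) := by linear_combination -he
  rw [h2, derivative_sub, h1, derivative_mul]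
  exact ⟨-(derivative Q * (f * e) + derivative (Q * (f * e))), by ring⟩

theorem vM_bdd (c : K[X]) : ∀ n ∈ {n : ℕ | ∃ (P : Polynomial K) (k : ℕ),
    P.Monic ∧ Irreducible P ∧ 1 ≤ k ∧ c = P ^ k ∧ n = P.natDegree}, n ≤ c.natDegree := by
  rintro n ⟨P, k, -, -, hk, rfl, rfl⟩
  rw [natDegree_pow]
  exact Nat.le_mul_of_pos_left _ hk

theorem vM_spec (c : K[X]) (h : vM c ≠ 0) : ∃ (P : Polynomial K) (k : ℕ),
    P.Monic ∧ Irreducible P ∧ 1 ≤ k ∧ c = P ^ k ∧ vM c = P.natDegree := by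
  have hne : {n : ℕ | ∃ (P : Polynomial K) (k : ℕ),
    P.Monic ∧ Irreducible P ∧ 1 ≤ k ∧ c = P ^ k ∧ n = P.natDegree}.Nonempty := by
    by_contra hcon
    rw [Set.not_nonempty_iff_eq_empty] at hcon
    apply h
    rw [vM, hcon]; simp
  exact Nat.sSup_mem hne ⟨c.natDegree, vM_bdd c⟩

theorem vM_le (c : K[X]) : vM c ≤ c.natDegree := by
  by_cases h : vM c = 0
  · omega
  · obtain ⟨P, k, h1, h2, h3, h4, h5⟩ := vM_spec c h
    exact vM_bdd c _ ⟨P, k, h1, h2, h3, h4, h5⟩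

theorem psi_small [Fintype K] (p : ℕ) [CharP K p] (hp : p.Prime) (r : ℕ) (hr : 1 ≤ r)
    (s : Finset K[X]) (hs : ∀ c ∈ s, c.natDegree = r ∧ derivative c = 0) :
    ((∑ c ∈ s, vM c : ℕ) : ℝ) ≤ (Fintype.card K : ℝ) ^ ((r : ℝ) / p) := by
  classical
  have hperf : PerfectField K := inferInstance
  set t := s.filter (fun c => vM c ≠ 0) with ht
  have hsum : ∑ c ∈ s, vM c = ∑ c ∈ t, vM c := by
    rw [ht, Finset.sum_filter_ne_zero]
  rcases t.eq_empty_or_nonempty with h0 | ⟨c0, hc0⟩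
  · rw [hsum, h0]; simp; positivity
  have hex : ∀ c : K[X], ∃ P : K[X], c ∈ t → ∃ k, P.Monic ∧ Irreducible P ∧ c = P ^ k ∧
      vM c = P.natDegree ∧ p ∣ k ∧ P.natDegree * k = r := by
    intro c
    by_cases hc : c ∈ t
    · rw [ht, Finset.mem_filter] at hc
      obtain ⟨P, k, h1, h2, h3, h4, h5⟩ := vM_spec c hc.2
      refine ⟨P, fun _ => ⟨k, h1, h2, h4, h5, ?_, ?_⟩⟩
      · have hd := (hs c hc.1).2
        rw [h4, derivative_pow] at hd
        have hP' : derivative P ≠ 0 := by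
          intro hz
          have hsep := PerfectField.separable_of_irreducible h2
          rw [separable_def, hz, isCoprime_zero_right] at hsep
          exact h2.not_isUnit hsep
        have hk0 : (C (k : K)) = 0 := by
          rcases mul_eq_zero.mp hd with h | h
          · rcases mul_eq_zero.mp h with h | h
            · exact h
            · exact absurd h (pow_ne_zero _ h2.ne_zero)
          · exact absurd h hP'
        rw [C_eq_zero] at hk0
        exact (CharP.cast_eq_zero_iff K p _).mp hk0
      · have := (hs c hc.1).1
        rw [h4, natDegree_pow] at this
        rw [Nat.mul_comm]; exact this
    · exact ⟨0, fun h => absurd h hc⟩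
  choose P hP using hex
  obtain ⟨m, hm⟩ : p ∣ r := by
    obtain ⟨k, -, -, -, -, h5, h6⟩ := hP c0 hc0
    rw [← h6]; exact Dvd.dvd.mul_left h5 _
  have hm0 : m ≠ 0 := by rintro rfl; omega
  have hdvd : ∏ c ∈ t, P c ∣ (X ^ (Nat.card K) ^ m - X : K[X]) := by
    apply Finset.prod_dvd_of_coprime
    · intro a ha b hb hab
      obtain ⟨k, h1, h2, h3, h4, h5, h6⟩ := hP a ha
      obtain ⟨l, g1, g2, g3, g4, g5, g6⟩ := hP b hb
      show IsCoprime (P a) (P b)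
      by_cases h : P a ∣ P b
      swap
      · exact (h2.coprime_iff_not_dvd).mpr h
      · exfalso
        apply hab
        have hass := h2.associated_of_dvd g2 h
        have heq := eq_of_monic_of_associated h1 g1 hass
        rw [heq] at h6
        have hkl : k = l := Nat.eq_of_mul_eq_mul_left g2.natDegree_pos (h6.trans g6.symm)
        rw [h3, g3, heq, hkl]
    · intro a ha
      obtain ⟨k, h1, h2, h3, h4, ⟨j, rfl⟩, h6⟩ := hP a ha
      rw [← h2.natDegree_dvd_iff_dvd_X_pow_card_pow_sub_X]
      refine ⟨j, ?_⟩
      apply Nat.eq_of_mul_eq_mul_left hp.pos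
      rw [← hm, ← h6]; ring
  have hle := natDegree_le_of_dvd hdvd
    (FiniteField.X_pow_card_pow_sub_X_ne_zero K hm0 Finite.one_lt_card)
  rw [FiniteField.X_pow_card_pow_sub_X_natDegree_eq K hm0 Finite.one_lt_card,
    natDegree_prod _ _ (fun c hc => by
      obtain ⟨k, h1, h2, -⟩ := hP c hc
      exact h2.ne_zero), Nat.card_eq_fintype_card] at hle
  have hfin : ∑ c ∈ s, vM c ≤ Fintype.card K ^ m := by
    rw [hsum]
    refine le_trans (le_of_eq ?_) hle
    apply Finset.sum_congr rfl
    intro c hc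
    obtain ⟨k, h1, h2, h3, h4, -⟩ := hP c hc
    exact h4
  have hexp : (r : ℝ) / p = (m : ℝ) := by
    have : (p : ℝ) ≠ 0 := by exact_mod_cast hp.ne_zero
    rw [hm]; push_cast; field_simp
  rw [hexp, Real.rpow_natCast]
  exact_mod_cast hfin

end Psi

/-- Let `p > 2` be prime, `F_q` a finite field of characteristic `p`, `g` monic squarefree,
`Q` a monic divisor of `g`, and `N = ((F_q[x]/gQ)ˣ)^p`. Then for every `r ≥ 1`:
`ψ(r; N) ≤ q^{r/p}` if `r ≤ deg Q`;
`ψ(r; N) ≤ r·q^{r/2 + (1/2 − 1/p)(r − 2 deg Q) + min(2p, r/p)}` if `deg Q < r < 2 deg Q`;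
`ψ(r; N) ≤ r·q^{r/2 + (r − 2 deg Q)/2 + min(2p, r/p)}` if `r ≥ 2 deg Q`;
where `ψ(r; N)` is the sum of `Λ(c)` over monic `c` of degree `r` with `c mod gQ ∈ N`. -/
theorem stmt_18 (p : ℕ) (hp : p.Prime) (hp2 : 2 < p)
    (Fq : Type*) [Field Fq] [Fintype Fq] [CharP Fq p]
    (g Q : Polynomial Fq) (hg : g.Monic) (hgsf : Squarefree g)
    (hQ : Q.Monic) (hQg : Q ∣ g) (r : ℕ) (hr : 1 ≤ r) :
    (r ≤ Q.natDegree →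
      ((∑ᶠ c ∈ {c : Polynomial Fq | c.Monic ∧ c.natDegree = r ∧
          ∃ w : (Polynomial Fq ⧸ Ideal.span {g * Q})ˣ,
            ((w ^ p : (Polynomial Fq ⧸ Ideal.span {g * Q})ˣ) :
                Polynomial Fq ⧸ Ideal.span {g * Q}) =
              Ideal.Quotient.mk (Ideal.span {g * Q}) c}, vM c : ℕ) : ℝ) ≤
        (Fintype.card Fq : ℝ) ^ ((r : ℝ) / (p : ℝ))) ∧
    (Q.natDegree < r → r < 2 * Q.natDegree →
      ((∑ᶠ c ∈ {c : Polynomial Fq | c.Monic ∧ c.natDegree = r ∧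
          ∃ w : (Polynomial Fq ⧸ Ideal.span {g * Q})ˣ,
            ((w ^ p : (Polynomial Fq ⧸ Ideal.span {g * Q})ˣ) :
                Polynomial Fq ⧸ Ideal.span {g * Q}) =
              Ideal.Quotient.mk (Ideal.span {g * Q}) c}, vM c : ℕ) : ℝ) ≤
        (r : ℝ) * (Fintype.card Fq : ℝ) ^
          ((r : ℝ) / 2 + (1 / 2 - 1 / (p : ℝ)) * ((r : ℝ) - 2 * (Q.natDegree : ℝ)) +
            min (2 * (p : ℝ)) ((r : ℝ) / (p : ℝ)))) ∧
    (2 * Q.natDegree ≤ r →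
      ((∑ᶠ c ∈ {c : Polynomial Fq | c.Monic ∧ c.natDegree = r ∧
          ∃ w : (Polynomial Fq ⧸ Ideal.span {g * Q})ˣ,
            ((w ^ p : (Polynomial Fq ⧸ Ideal.span {g * Q})ˣ) :
                Polynomial Fq ⧸ Ideal.span {g * Q}) =
              Ideal.Quotient.mk (Ideal.span {g * Q}) c}, vM c : ℕ) : ℝ) ≤
        (r : ℝ) * (Fintype.card Fq : ℝ) ^
          ((r : ℝ) / 2 + ((r : ℝ) - 2 * (Q.natDegree : ℝ)) / 2 +
            min (2 * (p : ℝ)) ((r : ℝ) / (p : ℝ)))) := by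
  classical
  have : PerfectField Fq := inferInstance
  set A : Set (Polynomial Fq) := {c : Polynomial Fq | c.Monic ∧ c.natDegree = r ∧
          ∃ w : (Polynomial Fq ⧸ Ideal.span {g * Q})ˣ,
            ((w ^ p : (Polynomial Fq ⧸ Ideal.span {g * Q})ˣ) :
                Polynomial Fq ⧸ Ideal.span {g * Q}) =
              Ideal.Quotient.mk (Ideal.span {g * Q}) c} with hA
  have hAfin : A.Finite := by
    have : Finite (degreeLT Fq (r + 1)) := Module.finite_of_finite Fq
    refine Set.Finite.subset (Set.toFinite (degreeLT Fq (r + 1) : Set (Polynomial Fq))) ?_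
    rintro c ⟨h1, h2, -⟩
    rw [SetLike.mem_coe, mem_degreeLT, degree_eq_natDegree h1.ne_zero, h2]
    exact_mod_cast Nat.lt_succ_self r
  have hprop : ∀ c ∈ hAfin.toFinset, c.Monic ∧ c.natDegree = r ∧ Q ∣ derivative c := by
    intro c hc
    rw [Set.Finite.mem_toFinset] at hc
    obtain ⟨h1, h2, w, hw⟩ := hc
    exact ⟨h1, h2, dvd_der_of_pow p g Q hQg c w hw⟩
  rw [finsum_mem_eq_finite_toFinset_sum _ hAfin]
  have hq1 : (1 : ℝ) ≤ Fintype.card Fq := by exact_mod_cast Fintype.card_pos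
  have hsep : Q.Separable :=
    PerfectField.separable_iff_squarefree.mpr (Squarefree.squarefree_of_dvd hQg hgsf)
  have hlarge : ∀ R, 2 * Q.natDegree ≤ R → Nat.count (SQ Q) R + Q.natDegree ≤ R := by
    intro R hR
    rw [← rank_eq_count, rank_large Q hQ hsep R hR]
  have hbound : ((∑ c ∈ hAfin.toFinset, vM c : ℕ) : ℝ) ≤
      r * (Fintype.card Fq : ℝ) ^ (Nat.count (SQ Q) r : ℝ) := by
    rw [Real.rpow_natCast]
    have h1 : ∑ c ∈ hAfin.toFinset, vM c ≤ hAfin.toFinset.card * r := by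
      rw [← smul_eq_mul]
      apply Finset.sum_le_card_nsmul
      intro c hc
      have := vM_le c
      rwa [(hprop c hc).2.1] at this
    have h2 := monic_count Q r _ hprop
    have h3 : ∑ c ∈ hAfin.toFinset, vM c ≤ r * Fintype.card Fq ^ Nat.count (SQ Q) r := by
      rw [Nat.mul_comm] at h1
      exact h1.trans (Nat.mul_le_mul_left _ h2)
    exact_mod_cast h3
  refine ⟨fun hrd => ?_, fun h1 h2 => ?_, fun h1 => ?_⟩
  · have hz : ∀ c ∈ hAfin.toFinset, c.natDegree = r ∧ derivative c = 0 := by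
      intro c hc
      obtain ⟨-, h2, h3⟩ := hprop c hc
      exact ⟨h2, der_zero_of_dvd Q c h3 (by omega) (by omega)⟩
    exact psi_small p hp r hr _ hz
  · refine hbound.trans (mul_le_mul_of_nonneg_left ?_ (by positivity))
    apply Real.rpow_le_rpow_of_exponent_le hq1
    exact comb_main p _ hp2 (SQ Q) (SQ_add p Q) (SQ_small p Q) hlarge r h1 h2
  · refine hbound.trans (mul_le_mul_of_nonneg_left ?_ (by positivity))
    apply Real.rpow_le_rpow_of_exponent_le hq1
    have h3 : (Nat.count (SQ Q) r : ℝ) + Q.natDegree ≤ r := by exact_mod_cast hlarge r h1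
    have h4 : 0 ≤ min (2 * (p : ℝ)) ((r : ℝ) / (p : ℝ)) := by positivity
    linarith
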